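/- Let k > ℓ ≥ 2 and t ≥ k-1 be integers, and suppose (t+1) divides n. Then the minimum number of edges of an ℓ-graph on n vertices in which every vertex is contained in at least C(t, k-1) copies of K_k^ℓ equals (n/ℓ)·C(t, ℓ-1), and this minimum is attained by the disjoint union of n/(t+1) copies of K_{t+1}^ℓ. -/

import Mathlib

open Finset

open scoped Classical

/-- `E` is the edge set of an `ℓ`-uniform hypergraph on vertex type `V`:
every edge is an `ℓ`-element set. -/
def IsLGraph {V : Type*} (ℓ : ℕ) (E : Finset (Finset V)) : Prop :=
  ∀ e ∈ E, e.card = ℓ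

/-- `S` is a copy of `K_k^ℓ` in the hypergraph with edge set `E`:
`S` has `k` vertices and every `ℓ`-element subset of `S` is an edge. -/
def IsCopy {V : Type*} (E : Finset (Finset V)) (ℓ k : ℕ) (S : Finset V) : Prop :=
  S.card = k ∧ ∀ e ⊆ S, e.card = ℓ → e ∈ E

/-- The number of copies of `K_k^ℓ` containing the vertex `v`. -/
noncomputable def copiesAt {V : Type*} [Fintype V] (E : Finset (Finset V)) (ℓ k : ℕ)
    (v : V) : ℕ :=
  ((univ : Finset (Finset V)).filter fun S => v ∈ S ∧ IsCopy E ℓ k S).card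

/-- The degree of a vertex: the number of edges containing it. -/
noncomputable def hdeg {V : Type*} (E : Finset (Finset V)) (v : V) : ℕ :=
  (E.filter fun e => v ∈ e).card

/-- The `(t,k)`-degree condition: every vertex is contained in at least
`C(t, k-1)` copies of `K_k^ℓ`. -/
def DegCond {V : Type*} [Fintype V] (E : Finset (Finset V)) (ℓ k t : ℕ) : Prop :=
  ∀ v : V, Nat.choose t (k - 1) ≤ copiesAt E ℓ k v

/-- `E` is extremal: it is an `ℓ`-graph satisfying the `(t,k)`-degree condition
with the minimum number of edges among all such `ℓ`-graphs on the same vertex set. -/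
def IsExtremal {V : Type*} [Fintype V] (E : Finset (Finset V)) (ℓ k t : ℕ) : Prop :=
  IsLGraph ℓ E ∧ DegCond E ℓ k t ∧
    ∀ E' : Finset (Finset V), IsLGraph ℓ E' → DegCond E' ℓ k t → E.card ≤ E'.card

/-- `A` is an isolated copy of `K_{t+1}^ℓ`: it is a copy of `K_{t+1}^ℓ` and
every edge meeting `A` is contained in `A`. -/
def IsIsolatedCopy {V : Type*} [DecidableEq V] (E : Finset (Finset V)) (ℓ t : ℕ)
    (A : Finset V) : Prop :=
  IsCopy E ℓ (t + 1) A ∧ ∀ e ∈ E, (e ∩ A).Nonempty → e ⊆ A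

/-- The disjoint union of `n/(t+1)` copies of `K_{t+1}^ℓ` on `Fin n`, the blocks being
the fibers of `x ↦ x / (t+1)`. -/
noncomputable def blockGraph (n t ℓ : ℕ) : Finset (Finset (Fin n)) :=
  ((univ : Finset (Fin n)).powersetCard ℓ).filter fun e =>
    ∃ b : ℕ, ∀ x ∈ e, (x : ℕ) / (t + 1) = b

/-- The sets of size `k` between `{v}` and `B` are counted by `C(|B| - 1, k - 1)`. -/
lemma card_filter_mem_subset_card {V : Type*} [Fintype V] {B : Finset V} {v : V} (hv : v ∈ B)
    {k : ℕ} (hk : 1 ≤ k) :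
    ((univ : Finset (Finset V)).filter fun S => v ∈ S ∧ S ⊆ B ∧ S.card = k).card =
      (B.card - 1).choose (k - 1) := by
  rw [← card_erase_of_mem hv, ← card_powersetCard]
  refine card_nbij' (fun S => S.erase v) (fun S => insert v S) ?_ ?_ ?_ ?_
  · intro S hS
    obtain ⟨h1, h2, h3⟩ : v ∈ S ∧ S ⊆ B ∧ S.card = k := by simpa using hS
    exact mem_coe.2 (mem_powersetCard.2 ⟨erase_subset_erase v h2, by rw [card_erase_of_mem h1, h3]⟩)
  · intro S hS
    obtain ⟨h1, h2⟩ := mem_powersetCard.1 (mem_coe.1 hS)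
    have hvS : v ∉ S := fun h => (mem_erase.1 (h1 h)).1 rfl
    have hSB : insert v S ⊆ B := insert_subset hv (h1.trans (erase_subset _ _))
    have hc : (insert v S).card = k := by rw [card_insert_of_notMem hvS]; omega
    simp [hSB, hc]
  · intro S hS
    obtain ⟨h1, -⟩ : v ∈ S ∧ S ⊆ B ∧ S.card = k := by simpa using hS
    exact insert_erase h1
  · intro S hS
    obtain ⟨h1, -⟩ := mem_powersetCard.1 (mem_coe.1 hS)
    exact erase_insert fun h => (mem_erase.1 (h1 h)).1 rfl

/-- The handshake identity for uniform hypergraphs. -/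
lemma sum_hdeg {V : Type*} [Fintype V] {E : Finset (Finset V)} {ℓ : ℕ} (hE : IsLGraph ℓ E) :
    ∑ v, hdeg E v = ℓ * E.card := by
  have h := sum_card_bipartiteAbove_eq_sum_card_bipartiteBelow
    (s := (univ : Finset V)) (t := E) fun v e => v ∈ e
  have h' : ∑ e ∈ E, (bipartiteBelow (fun v e => v ∈ e) (univ : Finset V) e).card =
      E.card * ℓ := by
    refine sum_const_nat fun e he => ?_
    rw [← hE e he]
    congr 1
    ext v
    simp [bipartiteBelow]
  rw [mul_comm, ← h', ← h]
  rfl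

/-- By the Kruskal–Katona theorem, many copies of `K_k^ℓ` at `v` force a large degree of `v`. -/
lemma choose_le_hdeg {n k ℓ t : ℕ} (hkl : ℓ ≤ k) (hl : 1 ≤ ℓ) (ht : k - 1 ≤ t) (htn : t ≤ n)
    {E : Finset (Finset (Fin n))} {v : Fin n} (h : t.choose (k - 1) ≤ copiesAt E ℓ k v) :
    t.choose (ℓ - 1) ≤ hdeg E v := by
  set C := (univ : Finset (Finset (Fin n))).filter fun S => v ∈ S ∧ IsCopy E ℓ k S with hC
  have hCcard : copiesAt E ℓ k v = C.card := by
    rw [hC, copiesAt]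
    congr
  have hmem : ∀ S ∈ C, v ∈ S ∧ IsCopy E ℓ k S := fun S hS => by simpa [hC] using hS
  set A : Finset (Finset (Fin n)) := C.image fun S => S.erase v with hA
  have hAcard : A.card = C.card := by
    rw [hA]
    refine card_image_of_injOn fun S hS T hT hST => ?_
    rw [← insert_erase (hmem S hS).1, ← insert_erase (hmem T hT).1, hST]
  have hsized : (A : Set (Finset (Fin n))).Sized (k - 1) := by
    intro S hS
    obtain ⟨T, hT, rfl⟩ := mem_image.1 (mem_coe.1 hS)
    rw [card_erase_of_mem (hmem T hT).1, (hmem T hT).2.1]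
  have hkk := Finset.kruskal_katona_lovasz_form (i := k - ℓ) (by omega) ht htn hsized (h.trans_eq (hCcard.trans hAcard.symm))
  rw [show k - 1 - (k - ℓ) = ℓ - 1 by omega] at hkk
  refine hkk.trans (card_le_card_of_injOn (fun s => (insert v s : Finset (Fin n))) ?_ ?_)
  · intro s hs
    obtain ⟨S, hS, hsS, hcard⟩ := mem_shadow_iterate_iff_exists_mem_card_add.1 (mem_coe.1 hs)
    have hSc := hsized hS
    obtain ⟨T, hT, rfl⟩ := mem_image.1 hS
    have hvs : v ∉ s := fun h => (mem_erase.1 (hsS h)).1 rfl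
    have hE : insert v s ∈ E := (hmem T hT).2.2 _
      (insert_subset (hmem T hT).1 (hsS.trans (erase_subset _ _)))
      (by rw [card_insert_of_notMem hvs]; omega)
    simp [hE]
  · have hv : ∀ s ∈ (shadow (α := Fin n))^[k - ℓ] A, v ∉ s := by
      intro s hs h
      obtain ⟨S, hS, hsS, -⟩ := mem_shadow_iterate_iff_exists_mem_card_add.1 hs
      obtain ⟨T, hT, rfl⟩ := mem_image.1 hS
      exact (mem_erase.1 (hsS h)).1 rfl
    intro s hs s' hs' hss
    simp only at hss
    rw [← erase_insert (hv s hs), ← erase_insert (hv s' hs'), hss]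

/-- Each block of `Fin n`, for `t + 1 ∣ n`, has `t + 1` elements. -/
lemma card_filter_div_eq {n t : ℕ} (hdvd : t + 1 ∣ n) (v : Fin n) :
    ((univ : Finset (Fin n)).filter fun x : Fin n => (x : ℕ) / (t + 1) = (v : ℕ) / (t + 1)).card =
      t + 1 := by
  obtain ⟨m, rfl⟩ := hdvd
  have hb : (v : ℕ) / (t + 1) < m := Nat.div_lt_of_lt_mul v.2
  set b := (v : ℕ) / (t + 1)
  have hlt : b * (t + 1) + (t + 1) ≤ (t + 1) * m := by nlinarith
  rw [← card_map Fin.valEmbedding]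
  convert Nat.card_Ico (b * (t + 1)) (b * (t + 1) + (t + 1)) using 2
  · ext x
    simp only [mem_map, mem_filter, mem_univ, true_and, Fin.valEmbedding_apply, mem_Ico]
    have key : x / (t + 1) = b ↔ b * (t + 1) ≤ x ∧ x < b * (t + 1) + (t + 1) := by
      rw [Nat.div_eq_iff (by omega)]
      omega
    constructor
    · rintro ⟨y, hy, rfl⟩
      exact key.1 hy
    · intro hx
      exact ⟨⟨x, by omega⟩, key.2 hx, rfl⟩
  · omega

lemma isLGraph_blockGraph (n t ℓ : ℕ) : IsLGraph ℓ (blockGraph n t ℓ) := fun _ he =>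
  (mem_powersetCard.1 (mem_filter.1 he).1).2

lemma hdeg_blockGraph {n t ℓ : ℕ} (hdvd : t + 1 ∣ n) (hl : 1 ≤ ℓ) (v : Fin n) :
    hdeg (blockGraph n t ℓ) v = t.choose (ℓ - 1) := by
  have h := card_filter_mem_subset_card
    (B := (univ : Finset (Fin n)).filter fun x : Fin n => (x : ℕ) / (t + 1) = (v : ℕ) / (t + 1))
    (v := v) (by simp) hl
  rw [card_filter_div_eq hdvd v, Nat.add_sub_cancel] at h
  rw [← h, hdeg]
  congr 1
  ext e
  simp only [blockGraph, mem_filter, mem_powersetCard, mem_univ, true_and, subset_univ]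
  constructor
  · rintro ⟨⟨hc, b, hb⟩, hv⟩
    exact ⟨hv, fun x hx => by simp [hb x hx, hb v hv], hc⟩
  · rintro ⟨hv, hs, hc⟩
    exact ⟨⟨hc, _, fun x hx => (mem_filter.1 (hs hx)).2⟩, hv⟩

lemma degCond_blockGraph {n t k : ℕ} (ℓ : ℕ) (hdvd : t + 1 ∣ n) (hk : 1 ≤ k) :
    DegCond (blockGraph n t ℓ) ℓ k t := by
  intro v
  have h := card_filter_mem_subset_card
    (B := (univ : Finset (Fin n)).filter fun x : Fin n => (x : ℕ) / (t + 1) = (v : ℕ) / (t + 1))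
    (v := v) (by simp) hk
  rw [card_filter_div_eq hdvd v, Nat.add_sub_cancel] at h
  rw [← h, copiesAt]
  refine card_le_card fun S hS => ?_
  simp only [mem_filter, mem_univ, true_and] at hS ⊢
  obtain ⟨hv, hs, hc⟩ := hS
  refine ⟨hv, hc, fun e he hec => ?_⟩
  exact mem_filter.2 ⟨mem_powersetCard.2 ⟨subset_univ _, hec⟩, _,
    fun x hx => (mem_filter.1 (hs (he hx))).2⟩

/-- If `(t+1) ∣ n`, then the minimum number of edges of an `ℓ`-graph on `n` vertices in which
every vertex lies in at least `C(t,k-1)` copies of `K_k^ℓ` equals `(n/ℓ)·C(t,ℓ-1)`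
(i.e. `ℓ` times the minimum is `n·C(t,ℓ-1)`), attained by the disjoint union of
`n/(t+1)` copies of `K_{t+1}^ℓ`. -/
theorem stmt4 (k ℓ t n : ℕ) (hkl : ℓ < k) (hl : 2 ≤ ℓ) (ht : k - 1 ≤ t)
    (hdvd : (t + 1) ∣ n) :
    IsLGraph ℓ (blockGraph n t ℓ) ∧ DegCond (blockGraph n t ℓ) ℓ k t ∧
      ℓ * (blockGraph n t ℓ).card = n * Nat.choose t (ℓ - 1) ∧
      ∀ E' : Finset (Finset (Fin n)), IsLGraph ℓ E' → DegCond E' ℓ k t →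
        (blockGraph n t ℓ).card ≤ E'.card := by
  have hL := isLGraph_blockGraph n t ℓ
  have hcard : ℓ * (blockGraph n t ℓ).card = n * Nat.choose t (ℓ - 1) := by
    rw [← sum_hdeg hL, sum_congr rfl fun v _ => hdeg_blockGraph hdvd (by omega) v]
    simp
  refine ⟨hL, degCond_blockGraph ℓ hdvd (by omega), hcard, fun E' hE' hdeg' => ?_⟩
  refine Nat.le_of_mul_le_mul_left ?_ (show 0 < ℓ by omega)
  rw [hcard, ← sum_hdeg hE']
  have hsum : ∑ _v : Fin n, t.choose (ℓ - 1) ≤ ∑ v, hdeg E' v := by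
    refine sum_le_sum fun v _ => ?_
    have htn : t + 1 ≤ n := Nat.le_of_dvd v.pos hdvd
    exact choose_le_hdeg hkl.le (by omega) ht (by omega) (hdeg' v)
  simpa using hsum
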